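/- Given memory m ≥ 3, it is possible to answer any quantile query with relative rank error at most 3·log₂(σ)/m: for every multiset S of n ≥ 1 values from [1,σ], there exists a q-digest with at most m nodes summarizing S such that, for every q ∈ (0,1), the quantile algorithm applied to this q-digest returns a value whose rank in S lies between qn and (q + 3·log₂(σ)/m)·n. -/

import Mathlib

open scoped Classical

namespace QDigest

/-- The node set of the complete binary tree `T` over the value range `[1, σ]`,
heap-indexed by `1, …, 2σ − 1`. -/
def nodes (σ : ℕ) : Finset ℕ := Finset.Icc 1 (2 * σ - 1)

/-- Total count `n` of a q-digest `count`. -/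
def total (σ : ℕ) (count : ℕ → ℕ) : ℕ := ∑ v ∈ nodes σ, count v

/-- Parent of a non-root node `v`. -/
def parent (v : ℕ) : ℕ := v / 2

/-- Sibling of a non-root node `v` (the other child of its parent);
maps the root `1` to the non-node `0`. -/
def sibling (v : ℕ) : ℕ := if v % 2 = 0 then v + 1 else v - 1

/-- Support (node set `Q`) of a q-digest. -/
def support (σ : ℕ) (count : ℕ → ℕ) : Finset ℕ :=
  (nodes σ).filter fun v => count v ≠ 0

/-- `u` is an ancestor of, or equal to, `v` in the heap-indexed tree. -/
def AncOrEq (u v : ℕ) : Prop := ∃ i : ℕ, v / 2 ^ i = u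

/-- The leaf corresponding to the value `x ∈ [1, σ]`. -/
def leafOf (σ x : ℕ) : ℕ := σ - 1 + x

/-- Sum of the counts over the proper ancestors of `v`. -/
def ancSum (count : ℕ → ℕ) (v : ℕ) : ℕ :=
  ∑ j ∈ Finset.Icc 1 (Nat.log 2 v), count (v / 2 ^ j)

/-- Width of the dyadic interval `range(v)` of node `v`. -/
def width (σ v : ℕ) : ℕ := σ / 2 ^ Nat.log 2 v

/-- Right endpoint `v.max` of the dyadic interval of node `v`. -/
def vmax (σ v : ℕ) : ℕ := (v + 1) * width σ v - σ

/-- Left endpoint `v.min` of the dyadic interval of node `v`. -/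
def vmin (σ v : ℕ) : ℕ := v * width σ v - σ + 1

/-- The q-digest `count` summarizes the multiset `S` of values from `[1, σ]`:
there is an assignment sending each element `x` of `S` to a node of `T` that is
an ancestor of (or equal to) the leaf corresponding to `x`, such that `count v`
is the number of elements assigned to `v`. -/
def Summarizes (σ : ℕ) (count : ℕ → ℕ) (S : Multiset ℕ) : Prop :=
  ∃ P : Multiset (ℕ × ℕ),
    P.map Prod.fst = S ∧
    (∀ p ∈ P, p.2 ∈ nodes σ ∧ AncOrEq p.2 (leafOf σ p.1)) ∧
    ∀ v : ℕ, count v = Multiset.card (P.filter fun p => p.2 = v)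

/-- `true(v)`: the number of elements of `S` lying in `range(v)`. -/
noncomputable def trueCount (σ : ℕ) (S : Multiset ℕ) (v : ℕ) : ℕ :=
  Multiset.card (S.filter fun x => AncOrEq v (leafOf σ x))

/-- `sub(v)`: sum of the counts over the subtree of `T` rooted at `v`. -/
noncomputable def subSum (σ : ℕ) (count : ℕ → ℕ) (v : ℕ) : ℕ :=
  ∑ u ∈ (nodes σ).filter (fun u => AncOrEq v u), count u

/-- `u` precedes `v`, or equals it, in the post-order of `T`: increasing right
endpoint `v.max`, ties broken by placing smaller intervals first. -/
def postLE (σ u v : ℕ) : Prop :=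
  vmax σ u < vmax σ v ∨ (vmax σ u = vmax σ v ∧ width σ u ≤ width σ v)

/-- One step of COMPRESS at the sibling pair whose parent is `u`: if digest
property (2) fails for the pair, its counts are added to the parent and zeroed. -/
def compressStep (nk : ℕ) (count : ℕ → ℕ) (u : ℕ) : ℕ → ℕ :=
  if count (2 * u) + count (2 * u + 1) + count u ≤ nk then
    fun w =>
      if w = u then count u + count (2 * u) + count (2 * u + 1)
      else if w = 2 * u ∨ w = 2 * u + 1 then 0 else count w
  else count

/-- COMPRESS(Q, n, k): process sibling pairs level by level from the leaves
upward, i.e. parents `σ - 1, σ - 2, …, 1`. -/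
def compress (σ n k : ℕ) (count : ℕ → ℕ) : ℕ → ℕ :=
  (((List.range (σ - 1)).reverse).map (· + 1)).foldl
    (fun c u => compressStep (n / k) c u) count

/-- Post-order traversal of the subtree rooted at `v` (with recursion fuel). -/
def postorderAux (σ : ℕ) : ℕ → ℕ → List ℕ
  | 0, v => [v]
  | fuel + 1, v =>
      if σ ≤ v then [v]
      else postorderAux σ fuel (2 * v) ++ postorderAux σ fuel (2 * v + 1) ++ [v]

/-- Post-order traversal of the complete binary tree over `[1, σ]`, `σ = 2 ^ h`. -/
def postorder (σ h : ℕ) : List ℕ := postorderAux σ h 1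

end QDigest

open QDigest
namespace QDigest

/-- Number of elements of `S` that the assignment `f` sends to the node `v`. -/
def assignedCount (S : Multiset ℕ) (f : ℕ → ℕ) (v : ℕ) : ℕ :=
  Multiset.card (S.filter fun x => f x = v)

lemma sum_assignedCount (S : Multiset ℕ) (f : ℕ → ℕ) (A : Finset ℕ) :
    ∑ w ∈ A, assignedCount S f w = Multiset.card (S.filter fun x => f x ∈ A) := by
  unfold assignedCount
  induction S using Multiset.induction_on with
  | empty => simp
  | cons a S ih =>
    simp only [Multiset.filter_cons, Multiset.card_add, Finset.sum_add_distrib, ih]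
    congr 1
    by_cases ha : f a ∈ A
    · rw [Finset.sum_eq_single (f a)]
      · simp [ha]
      · intro b _ hb
        simp [hb.symm]
      · exact fun hn => absurd ha hn
    · rw [Finset.sum_eq_zero]
      · simp [ha]
      · intro b hb
        have : f a ≠ b := fun e => ha (e ▸ hb)
        simp [this]

lemma assignedCount_ne_zero {S : Multiset ℕ} {f : ℕ → ℕ} {v : ℕ} :
    assignedCount S f v ≠ 0 ↔ ∃ x ∈ S, f x = v := by
  simp [assignedCount, Multiset.filter_eq_nil]

/-- Position of the dyadic interval of a node. -/
lemma node_spec {h v : ℕ} (hv : v ∈ nodes (2 ^ h)) :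
    ∃ i ≤ h, width (2 ^ h) v = 2 ^ i ∧ 2 ^ h ≤ v * 2 ^ i ∧ (v + 1) * 2 ^ i ≤ 2 * 2 ^ h ∧
      vmax (2 ^ h) v + 2 ^ h = (v + 1) * 2 ^ i := by
  have hv' : 1 ≤ v ∧ v ≤ 2 * 2 ^ h - 1 := by simpa [nodes] using hv
  have hpos : 0 < 2 ^ h := by positivity
  have hlt : v < 2 ^ (h + 1) := by rw [pow_succ]; omega
  have hlog : Nat.log 2 v ≤ h :=
    Nat.lt_succ_iff.mp (Nat.log_lt_of_lt_pow (by omega) hlt)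
  have hlow : 2 ^ Nat.log 2 v ≤ v := Nat.pow_log_le_self 2 (by omega)
  have hhigh : v + 1 ≤ 2 ^ (Nat.log 2 v + 1) := Nat.lt_pow_succ_log_self (by norm_num) v
  have hsplit : 2 ^ h = 2 ^ Nat.log 2 v * 2 ^ (h - Nat.log 2 v) := by
    rw [← pow_add]; congr 1; omega
  have hw : width (2 ^ h) v = 2 ^ (h - Nat.log 2 v) := by
    unfold width
    rw [Nat.pow_div hlog (by norm_num)]
  have h1 : 2 ^ h ≤ v * 2 ^ (h - Nat.log 2 v) := by
    conv_lhs => rw [hsplit]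
    exact Nat.mul_le_mul_right _ hlow
  refine ⟨h - Nat.log 2 v, Nat.sub_le _ _, hw, h1, ?_, ?_⟩
  · calc (v + 1) * 2 ^ (h - Nat.log 2 v)
        ≤ 2 ^ (Nat.log 2 v + 1) * 2 ^ (h - Nat.log 2 v) := Nat.mul_le_mul_right _ hhigh
      _ = 2 * 2 ^ h := by rw [hsplit]; ring
  · unfold vmax
    rw [hw]
    have : v * 2 ^ (h - Nat.log 2 v) ≤ (v + 1) * 2 ^ (h - Nat.log 2 v) :=
      Nat.mul_le_mul_right _ (Nat.le_succ v)
    omega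

lemma vmax_mem_Icc {h v : ℕ} (hv : v ∈ nodes (2 ^ h)) :
    1 ≤ vmax (2 ^ h) v ∧ vmax (2 ^ h) v ≤ 2 ^ h := by
  obtain ⟨i, -, -, h1, h2, h3⟩ := node_spec hv
  have : 0 < 2 ^ i := by positivity
  rw [add_mul] at h2 h3
  omega

/-- A node of width `2 ^ i` is the `i`-th ancestor of every leaf below it. -/
lemma leafOf_div_eq_of_ancOrEq {h i v x : ℕ} (hx : x ∈ Finset.Icc 1 (2 ^ h))
    (hanc : AncOrEq v (leafOf (2 ^ h) x)) (h1 : 2 ^ h ≤ v * 2 ^ i)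
    (h2 : (v + 1) * 2 ^ i ≤ 2 * 2 ^ h) :
    leafOf (2 ^ h) x / 2 ^ i = v := by
  obtain ⟨j, hj⟩ := hanc
  have hx' := Finset.mem_Icc.mp hx
  have hlow : 2 ^ h ≤ leafOf (2 ^ h) x := by unfold leafOf; omega
  have hhigh : leafOf (2 ^ h) x < 2 * 2 ^ h := by unfold leafOf; omega
  have hjl : v * 2 ^ j ≤ leafOf (2 ^ h) x := hj ▸ Nat.div_mul_le_self _ _
  have hjh : leafOf (2 ^ h) x < (v + 1) * 2 ^ j := by
    have := Nat.lt_mul_div_succ (leafOf (2 ^ h) x) (b := 2 ^ j) (by positivity)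
    rw [hj] at this
    linarith [mul_comm (2 ^ j) (v + 1)]
  have hij : i = j := by
    rcases lt_trichotomy i j with hlt | heq | hgt
    · have : 2 ^ (i + 1) ≤ 2 ^ j := Nat.pow_le_pow_right (by norm_num) hlt
      rw [pow_succ] at this
      nlinarith [Nat.mul_le_mul_left v this]
    · exact heq
    · have : 2 ^ (j + 1) ≤ 2 ^ i := Nat.pow_le_pow_right (by norm_num) hgt
      rw [pow_succ] at this
      nlinarith [Nat.mul_le_mul_left (v + 1) this]
  rw [hij, hj]

lemma le_vmax_of_ancOrEq {h v x : ℕ} (hv : v ∈ nodes (2 ^ h)) (hx : x ∈ Finset.Icc 1 (2 ^ h))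
    (hanc : AncOrEq v (leafOf (2 ^ h) x)) : x ≤ vmax (2 ^ h) v := by
  obtain ⟨i, -, -, h1, h2, h3⟩ := node_spec hv
  have he := leafOf_div_eq_of_ancOrEq hx hanc h1 h2
  have := Nat.lt_mul_div_succ (leafOf (2 ^ h) x) (b := 2 ^ i) (by positivity)
  rw [he, mul_comm, ← h3] at this
  unfold leafOf at this
  omega

/-- A node whose interval contains `x` and reaches at least to `y > x` is a proper ancestor
of the leaf of `y`. -/
lemma eq_leafOf_div_of_lt {h v x y : ℕ} (hv : v ∈ nodes (2 ^ h)) (hx : x ∈ Finset.Icc 1 (2 ^ h))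
    (hanc : AncOrEq v (leafOf (2 ^ h) x)) (hxy : x < y) (hy : y ≤ vmax (2 ^ h) v) :
    ∃ i ∈ Finset.Icc 1 h, leafOf (2 ^ h) y / 2 ^ i = v := by
  obtain ⟨i, hi, -, h1, h2, h3⟩ := node_spec hv
  have he := leafOf_div_eq_of_ancOrEq hx hanc h1 h2
  have hl : v * 2 ^ i ≤ leafOf (2 ^ h) x := he ▸ Nat.div_mul_le_self _ _
  have hpos : 0 < 2 ^ h := by positivity
  unfold leafOf at *
  refine ⟨i, Finset.mem_Icc.mpr ⟨?_, hi⟩, ?_⟩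
  · by_contra hi0
    have : i = 0 := by omega
    subst this
    simp only [pow_zero, mul_one] at *
    omega
  · apply Nat.div_eq_of_lt_le <;> omega

lemma postLE_antisymm {h u v : ℕ} (hu : u ∈ nodes (2 ^ h)) (hv : v ∈ nodes (2 ^ h))
    (huv : postLE (2 ^ h) u v) (hvu : postLE (2 ^ h) v u) : u = v := by
  obtain ⟨i, -, hi, -, -, h3⟩ := node_spec hu
  obtain ⟨j, -, hj, -, -, h4⟩ := node_spec hv
  unfold postLE at huv hvu
  have hm : vmax (2 ^ h) u = vmax (2 ^ h) v := by omega
  have hw : width (2 ^ h) u = width (2 ^ h) v := by omega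
  rw [← hi] at h3
  rw [← hj, ← hw, ← hm, h3] at h4
  have hpos : 0 < width (2 ^ h) u := by rw [hi]; positivity
  have := Nat.eq_of_mul_eq_mul_right hpos h4
  omega

lemma postLE_total (σ u v : ℕ) : postLE σ u v ∨ postLE σ v u := by
  unfold postLE; omega

lemma postLE_trans {σ u v w : ℕ} (huv : postLE σ u v) (hvw : postLE σ v w) : postLE σ u w := by
  unfold postLE at *; omega

/-- Every nonempty finite set of nodes has a first element in post-order. -/
lemma exists_postLE_least (σ : ℕ) {A : Finset ℕ} (hA : A.Nonempty) :
    ∃ v ∈ A, ∀ w ∈ A, postLE σ v w := by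
  induction hA using Finset.Nonempty.cons_induction with
  | singleton a => exact ⟨a, by simp, by simp [postLE]⟩
  | cons a s ha hs ih =>
    obtain ⟨v, hv, hle⟩ := ih
    rcases postLE_total σ a v with hav | hva
    · refine ⟨a, by simp, fun w hw => ?_⟩
      rcases Finset.mem_cons.mp hw with rfl | hw
      · simp [postLE]
      · exact postLE_trans hav (hle w hw)
    · refine ⟨v, by simp [hv], fun w hw => ?_⟩
      rcases Finset.mem_cons.mp hw with rfl | hw
      · exact hva
      · exact hle w hw

lemma exists_postLE_greatest (σ : ℕ) {A : Finset ℕ} (hA : A.Nonempty) :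
    ∃ v ∈ A, ∀ w ∈ A, postLE σ w v := by
  induction hA using Finset.Nonempty.cons_induction with
  | singleton a => exact ⟨a, by simp, by simp [postLE]⟩
  | cons a s ha hs ih =>
    obtain ⟨v, hv, hle⟩ := ih
    rcases postLE_total σ v a with hva | hav
    · refine ⟨a, by simp, fun w hw => ?_⟩
      rcases Finset.mem_cons.mp hw with rfl | hw
      · simp [postLE]
      · exact postLE_trans (hle w hw) hva
    · refine ⟨v, by simp [hv], fun w hw => ?_⟩
      rcases Finset.mem_cons.mp hw with rfl | hw
      · exact hav
      · exact hle w hw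

/-- The scan of the quantile algorithm stops at some node. -/
lemma exists_scan_stop {h : ℕ} {A : Finset ℕ} (hA : A ⊆ nodes (2 ^ h)) (hne : A.Nonempty)
    (c : ℕ → ℕ) {r : ℝ} (hr : 0 < r) (hrn : r ≤ ((∑ w ∈ A, c w : ℕ) : ℝ)) :
    ∃ v ∈ A, r ≤ ((∑ w ∈ A.filter (fun w => postLE (2 ^ h) w v), c w : ℕ) : ℝ) ∧
      ((∑ w ∈ A.filter (fun w => postLE (2 ^ h) w v ∧ w ≠ v), c w : ℕ) : ℝ) < r := by
  set B := A.filter fun v =>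
    r ≤ ((∑ w ∈ A.filter (fun w => postLE (2 ^ h) w v), c w : ℕ) : ℝ) with hB
  have hBne : B.Nonempty := by
    obtain ⟨g, hg, hgle⟩ := exists_postLE_greatest (2 ^ h) hne
    refine ⟨g, Finset.mem_filter.mpr ⟨hg, ?_⟩⟩
    rwa [Finset.filter_true_of_mem hgle]
  obtain ⟨v, hvB, hleast⟩ := exists_postLE_least (2 ^ h) hBne
  obtain ⟨hvA, hv⟩ := Finset.mem_filter.mp hvB
  refine ⟨v, hvA, hv, ?_⟩
  set C := A.filter (fun w => postLE (2 ^ h) w v ∧ w ≠ v) with hC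
  rcases C.eq_empty_or_nonempty with hCe | hCne
  · simpa [hCe] using hr
  obtain ⟨g, hg, hgle⟩ := exists_postLE_greatest (2 ^ h) hCne
  obtain ⟨hgA, hgv, hgne⟩ := Finset.mem_filter.mp hg
  by_contra! hge
  refine hgne (postLE_antisymm (hA hgA) (hA hvA) hgv (hleast g ?_))
  refine Finset.mem_filter.mpr ⟨hgA, hge.trans ?_⟩
  exact_mod_cast Finset.sum_le_sum_of_subset fun w hw =>
    Finset.mem_filter.mpr ⟨(Finset.mem_filter.mp hw).1, hgle w hw⟩

/-- The state reached by COMPRESS with threshold `t`, started from the exact leaf counts, once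
all sibling pairs with parent at least `j` have been processed. -/
structure CompressedFrom (σ t : ℕ) (S : Multiset ℕ) (f : ℕ → ℕ) (j : ℕ) : Prop where
  mem_nodes : ∀ x ∈ S, f x ∈ nodes σ
  ancOrEq : ∀ x ∈ S, AncOrEq (f x) (leafOf σ x)
  le_of_lt : ∀ x ∈ S, f x < σ → j ≤ f x
  count_le : ∀ v < σ, assignedCount S f v ≤ t
  lt_pair : ∀ v, j ≤ v / 2 → assignedCount S f v ≠ 0 →
    t < assignedCount S f (2 * (v / 2)) + assignedCount S f (2 * (v / 2) + 1)

lemma compressedFrom_leafOf {σ : ℕ} (t : ℕ) {S : Multiset ℕ} (hS : ∀ x ∈ S, x ∈ Finset.Icc 1 σ) :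
    CompressedFrom σ t S (leafOf σ) σ where
  mem_nodes x hx := by
    have := Finset.mem_Icc.mp (hS x hx)
    simp only [nodes, leafOf, Finset.mem_Icc]
    omega
  ancOrEq x _ := ⟨0, by simp⟩
  le_of_lt x hx hlt := by
    have := Finset.mem_Icc.mp (hS x hx)
    unfold leafOf at hlt
    omega
  count_le v hv := by
    have : assignedCount S (leafOf σ) v = 0 := by
      by_contra hne
      obtain ⟨x, hx, rfl⟩ := assignedCount_ne_zero.mp hne
      have := Finset.mem_Icc.mp (hS x hx)
      unfold leafOf at hv
      omega
    omega
  lt_pair v hv hne := by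
    obtain ⟨x, hx, rfl⟩ := assignedCount_ne_zero.mp hne
    have := Finset.mem_Icc.mp (hS x hx)
    unfold leafOf at hv
    omega

lemma CompressedFrom.step {σ t j : ℕ} {S : Multiset ℕ} {f : ℕ → ℕ}
    (H : CompressedFrom σ t S f (j + 1)) (hj : 1 ≤ j) (hjσ : j < σ) :
    ∃ g, CompressedFrom σ t S g j := by
  by_cases hmerge : assignedCount S f (2 * j) + assignedCount S f (2 * j + 1) ≤ t
  · have hfj : ∀ x ∈ S, f x ≠ j := fun x hx e => by
      have := H.le_of_lt x hx (by omega)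
      omega
    have hcj : assignedCount S (fun x => if f x / 2 = j then j else f x) j
        = assignedCount S f (2 * j) + assignedCount S f (2 * j + 1) := by
      have h1 := sum_assignedCount S f {2 * j, 2 * j + 1}
      rw [Finset.sum_pair (by omega)] at h1
      rw [h1, assignedCount]
      congr 1
      refine Multiset.filter_congr fun x hx => ?_
      have := hfj x hx
      simp only [Finset.mem_insert, Finset.mem_singleton]
      split_ifs <;> omega
    have hne : ∀ v, v ≠ j → v / 2 ≠ j →
        assignedCount S (fun x => if f x / 2 = j then j else f x) v = assignedCount S f v := by
      intro v hv hv2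
      unfold assignedCount
      congr 1
      refine Multiset.filter_congr fun x _ => ?_
      dsimp only
      split_ifs with hc
      · constructor
        · intro e; omega
        · intro e; subst e; exact absurd hc hv2
      · rfl
    have hzero : ∀ v, v / 2 = j →
        assignedCount S (fun x => if f x / 2 = j then j else f x) v = 0 := by
      intro v hv
      by_contra hc
      obtain ⟨x, -, hxv⟩ := assignedCount_ne_zero.mp hc
      split_ifs at hxv <;> grind
    refine ⟨fun x => if f x / 2 = j then j else f x, ?_, ?_, ?_, ?_, ?_⟩
    · intro x hx
      have := H.mem_nodes x hx
      simp only [nodes, Finset.mem_Icc] at this ⊢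
      split_ifs <;> omega
    · intro x hx
      obtain ⟨i, hi⟩ := H.ancOrEq x hx
      split_ifs with hc
      · exact ⟨i + 1, by rw [pow_succ, ← Nat.div_div_eq_div_mul, hi, hc]⟩
      · exact ⟨i, hi⟩
    · intro x hx
      have := H.le_of_lt x hx
      split_ifs <;> omega
    · intro v hv
      rcases eq_or_ne v j with rfl | hvj
      · rwa [hcj]
      · by_cases hv2 : v / 2 = j
        · rw [hzero v hv2]; omega
        · rw [hne v hvj hv2]; exact H.count_le v hv
    · intro v hv hc
      by_cases hv2 : v / 2 = j
      · exact absurd (hzero v hv2) hc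
      · rw [hne v (by omega) hv2] at hc
        rw [hne _ (by omega) (by omega), hne _ (by omega) (by omega)]
        exact H.lt_pair v (by omega) hc
  · refine ⟨f, H.mem_nodes, H.ancOrEq, ?_, H.count_le, ?_⟩
    · intro x hx hlt
      have := H.le_of_lt x hx hlt
      omega
    · intro v hv hc
      by_cases hv2 : v / 2 = j
      · rw [hv2]; omega
      · exact H.lt_pair v (by omega) hc

lemma exists_compressedFrom_one {σ : ℕ} (hσ : 1 ≤ σ) (t : ℕ) {S : Multiset ℕ}
    (hS : ∀ x ∈ S, x ∈ Finset.Icc 1 σ) : ∃ f, CompressedFrom σ t S f 1 := by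
  have key : ∀ d < σ, ∃ f, CompressedFrom σ t S f (σ - d) := by
    intro d
    induction d with
    | zero => exact fun _ => ⟨_, compressedFrom_leafOf t hS⟩
    | succ d ih =>
      intro hd
      obtain ⟨f, H⟩ := ih (by omega)
      rw [show σ - d = σ - (d + 1) + 1 by omega] at H
      exact H.step (by omega) (by omega)
  simpa [Nat.sub_sub_self hσ] using key (σ - 1) (by omega)

/-- Every sibling pair met by the support carries more than `t` elements. -/
lemma CompressedFrom.card_support_le {σ t : ℕ} {S : Multiset ℕ} {f : ℕ → ℕ}
    (H : CompressedFrom σ t S f 1) :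
    ∃ p, (support σ (assignedCount S f)).card ≤ 2 * p + 1 ∧ p * (t + 1) ≤ Multiset.card S := by
  set Q := support σ (assignedCount S f) with hQ
  set W := (Q.erase 1).image (· / 2) with hW
  have hmem : ∀ v ∈ Q, 1 ≤ v ∧ assignedCount S f v ≠ 0 := fun v hv => by
    simp only [hQ, support, nodes, Finset.mem_filter, Finset.mem_Icc] at hv
    exact ⟨hv.1.1, hv.2⟩
  refine ⟨W.card, ?_, ?_⟩
  · have hsub : Q ⊆ insert 1 (W.image (2 * ·) ∪ W.image (2 * · + 1)) := by
      intro v hv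
      by_cases h1 : v = 1
      · simp [h1]
      · have hw : v / 2 ∈ W := Finset.mem_image_of_mem _ (Finset.mem_erase.mpr ⟨h1, hv⟩)
        refine Finset.mem_insert_of_mem (Finset.mem_union.mpr ?_)
        rcases Nat.even_or_odd' v with ⟨k, hk | hk⟩
        · exact Or.inl (Finset.mem_image.mpr ⟨v / 2, hw, by omega⟩)
        · exact Or.inr (Finset.mem_image.mpr ⟨v / 2, hw, by omega⟩)
    have h1 := Finset.card_le_card hsub
    have h2 := Finset.card_insert_le 1 (W.image (2 * ·) ∪ W.image (2 * · + 1))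
    have h3 := Finset.card_union_le (W.image (2 * ·)) (W.image (2 * · + 1))
    have h4 := Finset.card_image_le (s := W) (f := (2 * ·))
    have h5 := Finset.card_image_le (s := W) (f := (2 * · + 1))
    omega
  · calc W.card * (t + 1)
        ≤ ∑ w ∈ W, (assignedCount S f (2 * w) + assignedCount S f (2 * w + 1)) := by
          rw [← smul_eq_mul]
          refine Finset.card_nsmul_le_sum _ _ _ fun w hw => ?_
          obtain ⟨v, hv, rfl⟩ := Finset.mem_image.mp hw
          obtain ⟨hv1, hv⟩ := Finset.mem_erase.mp hv
          have := hmem v hv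
          exact H.lt_pair v (by omega) this.2
      _ = ∑ v ∈ W.image (2 * ·) ∪ W.image (2 * · + 1), assignedCount S f v := by
          rw [Finset.sum_union, Finset.sum_image (g := (2 * ·)), Finset.sum_image (g := (2 * · + 1)),
            Finset.sum_add_distrib]
          · intro a _ b _ hab
            dsimp only at hab
            omega
          · intro a _ b _ hab
            dsimp only at hab
            omega
          · rw [Finset.disjoint_left]
            intro a ha hb
            obtain ⟨b, -, hb⟩ := Finset.mem_image.mp hb
            obtain ⟨c, -, hc⟩ := Finset.mem_image.mp ha
            omega
      _ ≤ Multiset.card S := by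
          rw [sum_assignedCount]
          exact Multiset.card_le_card (Multiset.filter_le _ _)

/-- The elements below `vmax v` that are not scanned before `v` lie on proper ancestors of the
leaf of `vmax v`. -/
lemma CompressedFrom.card_lt_vmax_le {h t j : ℕ} {S : Multiset ℕ} {f : ℕ → ℕ}
    (H : CompressedFrom (2 ^ h) t S f j) (hS : ∀ x ∈ S, x ∈ Finset.Icc 1 (2 ^ h))
    {v : ℕ} (hv : v ∈ nodes (2 ^ h)) :
    Multiset.card (S.filter fun x => x < vmax (2 ^ h) v) ≤
      Multiset.card (S.filter fun x => postLE (2 ^ h) (f x) v ∧ f x ≠ v) + h * t := by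
  have hy := vmax_mem_Icc hv
  set y := vmax (2 ^ h) v with hydef
  set A := (Finset.Icc 1 h).image fun i => leafOf (2 ^ h) y / 2 ^ i with hA
  have hAcard : Multiset.card (S.filter fun x => f x ∈ A) ≤ h * t := by
    rw [← sum_assignedCount]
    have hle : ∑ w ∈ A, assignedCount S f w ≤ A.card • t := by
      refine Finset.sum_le_card_nsmul _ _ _ fun w hw => H.count_le w ?_
      obtain ⟨i, hi, rfl⟩ := Finset.mem_image.mp hw
      have hi := (Finset.mem_Icc.mp hi).1
      have h2 : 2 ^ 1 ≤ 2 ^ i := Nat.pow_le_pow_right (by norm_num) hi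
      rw [Nat.div_lt_iff_lt_mul (by positivity)]
      have := Nat.mul_le_mul_left (2 ^ h) h2
      unfold leafOf
      omega
    have hc : A.card ≤ h := Finset.card_image_le.trans (by simp)
    exact hle.trans (Nat.mul_le_mul_right t hc)
  have hsplit : (S.filter fun x => x < y) ≤
      (S.filter fun x => postLE (2 ^ h) (f x) v ∧ f x ≠ v) + S.filter fun x => f x ∈ A := by
    rw [Multiset.filter_add_filter]
    refine le_trans ?_ (Multiset.le_add_right _ _)
    rw [Multiset.le_filter]
    refine ⟨Multiset.filter_le _ _, fun x hx => ?_⟩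
    obtain ⟨hxS, hxy⟩ := Multiset.mem_filter.mp hx
    by_cases hp : postLE (2 ^ h) (f x) v ∧ f x ≠ v
    · exact Or.inl hp
    · right
      have hle : y ≤ vmax (2 ^ h) (f x) := by
        by_cases he : f x = v
        · rw [he]
        · by_contra! hlt
          exact hp ⟨Or.inl hlt, he⟩
      obtain ⟨i, hi, he⟩ :=
        eq_leafOf_div_of_lt (H.mem_nodes x hxS) (hS x hxS) (H.ancOrEq x hxS) hxy hle
      exact Finset.mem_image.mpr ⟨i, hi, he⟩
  have := Multiset.card_le_card hsplit
  rw [Multiset.card_add] at this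
  omega

end QDigest

/-- given memory `m ≥ 3`, any quantile query can be answered with
relative rank error at most `3·log₂(σ)/m`: for every multiset `S` of `n ≥ 1`
values from `[1, σ]` there exists a q-digest with at most `m` nodes summarizing
`S` such that for every `q ∈ (0,1)` the quantile algorithm (scan the post-order
list, report `v.max` for the first node `v` at which the accumulated count
reaches at least `q·n`) succeeds and returns a value whose rank in `S` lies
between `q·n` and `(q + 3·log₂(σ)/m)·n`: at least `q·n` elements of `S` are
`≤ v.max` and at most `(q + 3·log₂(σ)/m)·n` elements of `S` are `< v.max`. -/
theorem qdigest_main_theorem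
    (h σ m : ℕ) (hh : 1 ≤ h) (hσ : σ = 2 ^ h) (hm : 3 ≤ m)
    (S : Multiset ℕ) (n : ℕ) (hn : 1 ≤ n) (hcard : Multiset.card S = n)
    (hS : ∀ x ∈ S, x ∈ Finset.Icc 1 σ) :
    ∃ count : ℕ → ℕ,
      (∀ v, count v ≠ 0 → v ∈ nodes σ) ∧
      Summarizes σ count S ∧
      (support σ count).card ≤ m ∧
      ∀ q : ℝ, 0 < q → q < 1 →
        (∃ v ∈ support σ count,
          q * (n : ℝ) ≤ ((∑ w ∈ (support σ count).filter (fun w => postLE σ w v),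
              count w : ℕ) : ℝ) ∧
          ((∑ w ∈ (support σ count).filter (fun w => postLE σ w v ∧ w ≠ v),
              count w : ℕ) : ℝ) < q * (n : ℝ)) ∧
        ∀ v ∈ support σ count,
          q * (n : ℝ) ≤ ((∑ w ∈ (support σ count).filter (fun w => postLE σ w v),
              count w : ℕ) : ℝ) →
          ((∑ w ∈ (support σ count).filter (fun w => postLE σ w v ∧ w ≠ v),
              count w : ℕ) : ℝ) < q * (n : ℝ) →
          q * (n : ℝ) ≤ (Multiset.card (S.filter fun x => x ≤ vmax σ v) : ℝ) ∧
          (Multiset.card (S.filter fun x => x < vmax σ v) : ℝ)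
            ≤ (q + 3 * (Nat.log 2 σ : ℝ) / (m : ℝ)) * (n : ℝ) := by
  subst hσ
  obtain ⟨f, H⟩ := exists_compressedFrom_one (Nat.one_le_two_pow (n := h)) (3 * n / m) hS
  have hmR : (0 : ℝ) < m := by exact_mod_cast (by omega : 0 < m)
  have hnR : (0 : ℝ) < n := by exact_mod_cast hn
  have hnodes : support (2 ^ h) (assignedCount S f) ⊆ nodes (2 ^ h) := Finset.filter_subset _ _
  have hmem : ∀ x ∈ S, f x ∈ support (2 ^ h) (assignedCount S f) := fun x hx =>
    Finset.mem_filter.mpr ⟨H.mem_nodes x hx, assignedCount_ne_zero.mpr ⟨x, hx, rfl⟩⟩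
  have hsum : ∀ (p : ℕ → Prop) [DecidablePred p],
      ∑ w ∈ (support (2 ^ h) (assignedCount S f)).filter p, assignedCount S f w
        = Multiset.card (S.filter fun x => p (f x)) := fun p _ => by
    rw [sum_assignedCount]
    congr 1
    exact Multiset.filter_congr fun x hx => by simp [hmem x hx]
  refine ⟨assignedCount S f, ?_, ?_, ?_, ?_⟩
  · intro v hv
    obtain ⟨x, hx, rfl⟩ := assignedCount_ne_zero.mp hv
    exact H.mem_nodes x hx
  · refine ⟨S.map fun x => (x, f x), by simp, ?_, ?_⟩
    · intro p hp
      obtain ⟨x, hx, rfl⟩ := Multiset.mem_map.mp hp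
      exact ⟨H.mem_nodes x hx, H.ancOrEq x hx⟩
    · intro v
      simp [assignedCount, Multiset.filter_map]
  · obtain ⟨p, hp1, hp2⟩ := H.card_support_le
    rw [hcard] at hp2
    have hlt : 3 * n < m * (3 * n / m + 1) := Nat.lt_mul_div_succ _ (by omega)
    have hpm : 3 * p ≤ m := by
      refine Nat.le_of_mul_le_mul_right (c := n) ?_ (by omega)
      calc 3 * p * n = p * (3 * n) := by ring
        _ ≤ p * (m * (3 * n / m + 1)) := Nat.mul_le_mul_left _ hlt.le
        _ = m * (p * (3 * n / m + 1)) := by ring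
        _ ≤ m * n := Nat.mul_le_mul_left _ hp2
    omega
  · intro q hq0 hq1
    refine ⟨?_, ?_⟩
    · refine exists_scan_stop hnodes ?_ _ (by positivity) ?_
      · obtain ⟨x, hx⟩ := Multiset.card_pos_iff_exists_mem.mp (by omega : 0 < Multiset.card S)
        exact ⟨_, hmem x hx⟩
      · rw [sum_assignedCount, Multiset.filter_eq_self.mpr hmem, hcard]
        nlinarith
    · intro v hv hge hlt
      rw [hsum] at hge hlt
      refine ⟨hge.trans ?_, ?_⟩
      · norm_cast
        refine Multiset.card_le_card (Multiset.le_filter.mpr ⟨Multiset.filter_le _ _, ?_⟩)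
        intro x hx
        obtain ⟨hxS, hxv⟩ := Multiset.mem_filter.mp hx
        have hxle := le_vmax_of_ancOrEq (H.mem_nodes x hxS) (hS x hxS) (H.ancOrEq x hxS)
        rcases hxv with hlt' | ⟨heq, -⟩ <;> omega
      · have hle := H.card_lt_vmax_le hS (hnodes hv)
        have ht : ((3 * n / m : ℕ) : ℝ) ≤ 3 * n / m := by
          simpa using Nat.cast_div_le (α := ℝ) (m := 3 * n) (n := m)
        have hleR : (Multiset.card (S.filter fun x => x < vmax (2 ^ h) v) : ℝ) ≤
            Multiset.card (S.filter fun x => postLE (2 ^ h) (f x) v ∧ f x ≠ v)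
              + h * ((3 * n / m : ℕ) : ℝ) := by exact_mod_cast hle
        have hmul := mul_le_mul_of_nonneg_left ht (Nat.cast_nonneg (α := ℝ) h)
        rw [Nat.log_pow (by norm_num)]
        have hring : (q + 3 * (h : ℝ) / m) * n = q * n + h * (3 * n / m) := by ring
        rw [hring]
        linarith
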